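/- Let 0 < p < 1. For every κ > 0 there exists a constant C > 0, depending only on A, k, m, n, p and κ, such that for every global weak solution u of the problem, all R > 0 and all R ≤ r_1 < r_2 ≤ 2R, setting J(r) = (mes Q_{2R}^κ)^{−1} ∫_{Q_r^κ} |u| dx dt, at least one of the following two inequalities holds: (i) J(r_2) − J(r_1) ≥ C (r_2 − r_1)^k R^{k(κ−1)} f(J(r_1)); (ii) J(r_2) − J(r_1) ≥ C (r_2 − r_1)^{m/p} f(J(r_1))^{1/p}. -/

import Mathlib

open MeasureTheory Real Set Filter

noncomputable section

/-- The spatial domain `ℝⁿ`. -/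
abbrev Spc (n : ℕ) := EuclideanSpace ℝ (Fin n)

/-- The open ball `B_r` in `ℝⁿ` of radius `r` centered at `0`. -/
def ball0 (n : ℕ) (r : ℝ) : Set (Spc n) := Metric.ball 0 r

/-- The cylinder `Q_r^κ = B_r × (0, r^κ)`. -/
def cyl (n : ℕ) (r κ : ℝ) : Set (Spc n × ℝ) := ball0 n r ×ˢ Ioo 0 (r ^ κ)

/-- The half-space `ℝ^{n+1}_+ = ℝⁿ × (0, ∞)`. -/
def halfSp (n : ℕ) : Set (Spc n × ℝ) := {z | 0 < z.2}

/-- The (finite) set of multi-indices `α` with `|α| = m`. -/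
def mIdx (n m : ℕ) : Finset (Fin n → ℕ) :=
  (Fintype.piFinset fun _ : Fin n => Finset.range (m + 1)).filter fun α => ∑ i, α i = m

/-- Spatial partial derivative `∂/∂x_i`. -/
def spDeriv (n : ℕ) (i : Fin n) (φ : Spc n × ℝ → ℝ) : Spc n × ℝ → ℝ :=
  fun z => deriv (fun s : ℝ => φ (z.1 + s • EuclideanSpace.single i (1 : ℝ), z.2)) 0

/-- Time derivative `∂/∂t`. -/
def tDeriv (n : ℕ) (φ : Spc n × ℝ → ℝ) : Spc n × ℝ → ℝ :=
  fun z => deriv (fun s : ℝ => φ (z.1, s)) z.2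

/-- Multi-index spatial derivative `∂^α`. -/
def mDeriv (n : ℕ) (α : Fin n → ℕ) (φ : Spc n × ℝ → ℝ) : Spc n × ℝ → ℝ :=
  (List.finRange n).foldr (fun i ψ => (spDeriv n i)^[α i] ψ) φ

/-- Caratheodory conditions and the growth bound `|a_α(x,t,ζ)| ≤ A |ζ|^p` for the
coefficients of the operator `L`. -/
def GoodCoeffs (n m : ℕ) (A p : ℝ) (a : (Fin n → ℕ) → Spc n × ℝ → ℝ → ℝ) : Prop :=
  ∀ α ∈ mIdx n m,
    (∀ ζ : ℝ, Measurable fun z => a α z ζ) ∧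
    (∀ᵐ z ∂(volume.restrict (halfSp n)), Continuous fun ζ => a α z ζ) ∧
    (∀ᵐ z ∂(volume.restrict (halfSp n)), ∀ ζ : ℝ, |a α z ζ| ≤ A * |ζ| ^ p)

/-- The standing conditions on `f`: `ζ ↦ f ζ` and `ζ ↦ f (ζ^{1/p})` are nondecreasing
and convex on `[0,∞)`, and `f` is positive on `(0,∞)`. -/
def GoodF (p : ℝ) (f : ℝ → ℝ) : Prop :=
  MonotoneOn f (Ici 0) ∧ ConvexOn ℝ (Ici 0) f ∧
  MonotoneOn (fun ζ => f (ζ ^ (1 / p))) (Ici 0) ∧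
  ConvexOn ℝ (Ici 0) (fun ζ => f (ζ ^ (1 / p))) ∧
  ∀ ζ : ℝ, 0 < ζ → 0 < f ζ

/-- Condition (1.4): `∫_1^∞ ζ^{1/k - 1} f(ζ)^{-1/k} dζ < ∞`. -/
def Cond14 (k : ℕ) (f : ℝ → ℝ) : Prop :=
  IntegrableOn (fun ζ : ℝ => ζ ^ ((k : ℝ)⁻¹ - 1) / f ζ ^ ((k : ℝ)⁻¹)) (Ioi 1)

/-- Condition (1.5): `∫_1^∞ ζ^{p/m - 1} f(ζ)^{-1/m} dζ < ∞`. -/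
def Cond15 (m : ℕ) (p : ℝ) (f : ℝ → ℝ) : Prop :=
  IntegrableOn (fun ζ : ℝ => ζ ^ (p / (m : ℝ) - 1) / f ζ ^ ((m : ℝ)⁻¹)) (Ioi 1)

/-- `v ∈ L^1_loc(ℝⁿ)`. -/
def L1locInit (n : ℕ) (v : Spc n → ℝ) : Prop :=
  ∀ r : ℝ, 0 < r → IntegrableOn v (ball0 n r)

/-- `u` is a global weak solution of
`∂_t^k u - Σ_{|α| = m} ∂^α a_α(x,t,u) ≥ f(|u|)` in `ℝ^{n+1}_+`, with initial data
`∂_t^i u(·,0) = u0 i` for `0 ≤ i ≤ k-1`. -/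
def IsGlobalWeakSol (n k m : ℕ) (p : ℝ) (a : (Fin n → ℕ) → Spc n × ℝ → ℝ → ℝ)
    (f : ℝ → ℝ) (u0 : ℕ → Spc n → ℝ) (u : Spc n × ℝ → ℝ) : Prop :=
  (∀ r : ℝ, 0 < r → IntegrableOn u (cyl n r 1)) ∧
  (∀ r : ℝ, 0 < r → IntegrableOn (fun z => |u z| ^ p) (cyl n r 1)) ∧
  (∀ r : ℝ, 0 < r → IntegrableOn (fun z => f |u z|) (cyl n r 1)) ∧
  ∀ φ : Spc n × ℝ → ℝ, ContDiff ℝ (⊤ : ℕ∞) φ → HasCompactSupport φ →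
    (∀ z, 0 ≤ φ z) →
    (∫ z in halfSp n, (-1 : ℝ) ^ k * u z * (tDeriv n)^[k] φ z)
      - (∫ z in halfSp n, ∑ α ∈ mIdx n m, (-1 : ℝ) ^ m * a α z (u z) * mDeriv n α φ z)
    ≥ (∫ x : Spc n, ∑ i ∈ Finset.range k,
          (-1 : ℝ) ^ i * u0 (k - 1 - i) x * (tDeriv n)^[i] φ (x, 0))
      + ∫ z in halfSp n, f |u z| * φ z

/-- `u = 0` almost everywhere in `ℝ^{n+1}_+`. -/
def TrivialSol (n : ℕ) (u : Spc n × ℝ → ℝ) : Prop :=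
  ∀ᵐ z ∂(volume.restrict (halfSp n)), u z = 0

/-- The standing hypotheses of Section 3: the coefficients are Caratheodory functions
with the growth bound, `f` satisfies the monotonicity/convexity/positivity conditions
together with (1.4) and (1.5), and the initial data are locally integrable with
`u_{k-1} ≥ 0` a.e. -/
def Standing (n k m : ℕ) (A p : ℝ) (a : (Fin n → ℕ) → Spc n × ℝ → ℝ → ℝ)
    (f : ℝ → ℝ) (u0 : ℕ → Spc n → ℝ) : Prop :=
  GoodCoeffs n m A p a ∧ GoodF p f ∧
  (∀ i < k, L1locInit n (u0 i)) ∧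
  (∀ᵐ x ∂(volume : Measure (Spc n)), 0 ≤ u0 (k - 1) x) ∧
  Cond14 k f ∧ Cond15 m p f

theorem norm_iteratedFDeriv_continuousLinearMap_le {F G : Type*} [NormedAddCommGroup F]
    [NormedSpace ℝ F] [NormedAddCommGroup G] [NormedSpace ℝ G] (L : F →L[ℝ] G) (i : ℕ) (x : F) :
    ‖iteratedFDeriv ℝ i L x‖ ≤ if i = 0 then ‖L x‖ else if i = 1 then ‖L‖ else 0 := by
  match i with
  | 0 => simp
  | i + 1 =>
    have h : fderiv ℝ (L : F → G) = fun _ => L := by ext1 y; exact L.fderiv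
    rw [← norm_iteratedFDeriv_fderiv, h]
    rcases Nat.eq_zero_or_pos i with rfl | hi
    · simp
    · rw [iteratedFDeriv_const_of_ne hi.ne']
      simp [hi.ne']

theorem norm_iteratedFDeriv_quadratic_le {F : Type*} [NormedAddCommGroup F]
    [InnerProductSpace ℝ F] (c d : ℝ) (i : ℕ) (hi : 1 ≤ i) (x : F) {D : ℝ} (hD : 0 ≤ D)
    (h1 : 2 * |c| * ‖x‖ ≤ D) (h2 : 2 * |c| ≤ D ^ 2) :
    ‖iteratedFDeriv ℝ i (fun y : F => c * ‖y‖ ^ 2 + d) x‖ ≤ D ^ i := by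
  obtain ⟨i, rfl⟩ : ∃ j, i = j + 1 := ⟨i - 1, by omega⟩
  have h : fderiv ℝ (fun y : F => c * ‖y‖ ^ 2 + d) = ((2 * c) • innerSL ℝ : F →L[ℝ] F →L[ℝ] ℝ) := by
    ext1 y
    have := ((hasStrictFDerivAt_norm_sq y).hasFDerivAt.const_mul c).add_const d
    rw [this.fderiv]
    ext z
    simp
    ring
  rw [← norm_iteratedFDeriv_fderiv, h]
  refine (norm_iteratedFDeriv_continuousLinearMap_le _ i x).trans ?_
  split_ifs with h0 h1'
  · subst h0
    calc ‖(2 * c) • innerSL ℝ x‖ = 2 * |c| * ‖x‖ := by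
          rw [norm_smul, innerSL_apply_norm, Real.norm_eq_abs, abs_mul, abs_two]
      _ ≤ D ^ (0 + 1) := by simpa using h1
  · subst h1'
    refine le_trans ?_ h2
    rw [norm_smul]
    have : ‖(innerSL ℝ : F →L[ℝ] F →L[ℝ] ℝ)‖ ≤ 1 :=
      ContinuousLinearMap.opNorm_le_bound _ zero_le_one fun y => by simp
    calc ‖2 * c‖ * ‖(innerSL ℝ : F →L[ℝ] F →L[ℝ] ℝ)‖ ≤ ‖2 * c‖ * 1 := by gcongr
      _ = 2 * |c| := by simp
  · positivity

theorem exists_bound_iteratedFDeriv_smoothTransition (j : ℕ) (K : Set ℝ) (hK : IsCompact K) :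
    ∃ C : ℝ, 0 < C ∧ ∀ s ∈ K, ∀ i ≤ j, ‖iteratedFDeriv ℝ i Real.smoothTransition s‖ ≤ C := by
  have hc : ContinuousOn
      (fun s => ∑ i ∈ Finset.range (j + 1), ‖iteratedFDeriv ℝ i Real.smoothTransition s‖) K := by
    refine (continuous_finsetSum _ fun i _ => ?_).continuousOn
    exact ((Real.smoothTransition.contDiff (n := i)).continuous_iteratedFDeriv le_rfl).norm
  obtain ⟨C, hC⟩ := hK.exists_bound_of_continuousOn hc
  refine ⟨max C 1, by positivity, fun s hs i hi => le_max_of_le_left ?_⟩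
  refine le_trans ?_ ((le_abs_self _).trans (hC s hs))
  exact Finset.single_le_sum (f := fun i => ‖iteratedFDeriv ℝ i Real.smoothTransition s‖)
    (fun _ _ => norm_nonneg _) (Finset.mem_range.2 (by omega))

/-- A smooth function with values in `[0, 1]` which is `1` near the closed ball of radius `a` and
`0` near the complement of the open ball of radius `b`. -/
structure IsCutoff {F : Type*} [NormedAddCommGroup F] [NormedSpace ℝ F] (a b : ℝ) (ψ : F → ℝ) :
    Prop where
  contDiff : ContDiff ℝ (⊤ : ℕ∞) ψ
  nonneg : ∀ x, 0 ≤ ψ x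
  le_one : ∀ x, ψ x ≤ 1
  eventually_one : ∀ x, ‖x‖ ≤ a → ψ =ᶠ[nhds x] fun _ => 1
  eventually_zero : ∀ x, b ≤ ‖x‖ → ψ =ᶠ[nhds x] fun _ => 0

namespace IsCutoff

variable {F : Type*} [NormedAddCommGroup F] [NormedSpace ℝ F] {a b : ℝ} {ψ : F → ℝ}

theorem eq_one (h : IsCutoff a b ψ) {x : F} (hx : ‖x‖ ≤ a) : ψ x = 1 :=
  (h.eventually_one x hx).eq_of_nhds

theorem eq_zero (h : IsCutoff a b ψ) {x : F} (hx : b ≤ ‖x‖) : ψ x = 0 :=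
  (h.eventually_zero x hx).eq_of_nhds

theorem iteratedFDeriv_eq_zero (h : IsCutoff a b ψ) {j : ℕ} (hj : j ≠ 0) {x : F}
    (hx : ‖x‖ ≤ a ∨ b ≤ ‖x‖) : iteratedFDeriv ℝ j ψ x = 0 := by
  rcases hx with hx | hx
  · rw [((h.eventually_one x hx).iteratedFDeriv ℝ j).eq_of_nhds, iteratedFDeriv_const_of_ne hj]
    rfl
  · rw [((h.eventually_zero x hx).iteratedFDeriv ℝ j).eq_of_nhds, iteratedFDeriv_const_of_ne hj]
    rfl

end IsCutoff

theorem exists_isCutoff (F : Type*) [NormedAddCommGroup F] [InnerProductSpace ℝ F] (j : ℕ)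
    (hj : j ≠ 0) :
    ∃ C : ℝ, 0 < C ∧ ∀ a b : ℝ, 0 < a → a < b → ∃ ψ : F → ℝ, IsCutoff a b ψ ∧
      ∀ x, ‖iteratedFDeriv ℝ j ψ x‖ ≤ C / (b - a) ^ j := by
  obtain ⟨C, hC0, hC⟩ := exists_bound_iteratedFDeriv_smoothTransition j (Icc (-1) 2) isCompact_Icc
  refine ⟨j.factorial * C * 6 ^ j, by positivity, fun a b ha hab => ?_⟩
  have hab' : 0 < b ^ 2 - a ^ 2 := by nlinarith
  have hba : 0 < b - a := sub_pos.2 hab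
  set c : ℝ := -3 / (b ^ 2 - a ^ 2) with hc
  set d : ℝ := 2 + 3 * a ^ 2 / (b ^ 2 - a ^ 2) with hd
  have hcd : ∀ s : ℝ, c * s + d = 2 - 3 * ((s - a ^ 2) / (b ^ 2 - a ^ 2)) := by
    intro s; rw [hc, hd]; field_simp; ring
  let h : F → ℝ := fun y => c * ‖y‖ ^ 2 + d
  have hh : ∀ {N : WithTop ℕ∞}, ContDiff ℝ N h := fun {N} =>
    (contDiff_const.mul (contDiff_norm_sq ℝ)).add contDiff_const
  have hcut : IsCutoff a b (Real.smoothTransition ∘ h) := by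
    refine ⟨Real.smoothTransition.contDiff.comp hh, fun x => Real.smoothTransition.nonneg _,
      fun x => Real.smoothTransition.le_one _, fun x hx => ?_, fun x hx => ?_⟩
    · have : 1 < h x := by
        have : (‖x‖ ^ 2 - a ^ 2) / (b ^ 2 - a ^ 2) ≤ 0 :=
          div_nonpos_of_nonpos_of_nonneg (by nlinarith [norm_nonneg x]) hab'.le
        simp only [h, hcd]; linarith
      filter_upwards [(hh (N := 0)).continuous.continuousAt.eventually (lt_mem_nhds this)] with y hy
      exact Real.smoothTransition.one_of_one_le hy.le
    · have : h x < 0 := by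
        have : 1 ≤ (‖x‖ ^ 2 - a ^ 2) / (b ^ 2 - a ^ 2) := by
          rw [le_div_iff₀ hab']; nlinarith [norm_nonneg x]
        simp only [h, hcd]; linarith
      filter_upwards [(hh (N := 0)).continuous.continuousAt.eventually (gt_mem_nhds this)] with y hy
      exact Real.smoothTransition.zero_of_nonpos hy.le
  refine ⟨_, hcut, fun x => ?_⟩
  by_cases hx : ‖x‖ ≤ a ∨ b ≤ ‖x‖
  · rw [hcut.iteratedFDeriv_eq_zero hj hx, norm_zero]; positivity
  push Not at hx
  have hcabs : |c| = 3 / ((b - a) * (b + a)) := by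
    rw [hc, neg_div, abs_neg, abs_of_pos (by positivity)]; congr 1; ring
  have key := norm_iteratedFDeriv_comp_le (n := j) (N := j) (D := 6 / (b - a))
    (g := Real.smoothTransition) (f := h) Real.smoothTransition.contDiff hh le_rfl x (C := C)
    (fun i hi => hC _ ?_ i hi) (fun i hi _ => norm_iteratedFDeriv_quadratic_le c d i hi x
      (by positivity) ?_ ?_)
  · rw [div_pow] at key
    calc _ ≤ _ := key
      _ = _ := by ring
  · have h1 : (‖x‖ ^ 2 - a ^ 2) / (b ^ 2 - a ^ 2) ≤ 1 := by
      rw [div_le_one hab']; nlinarith [norm_nonneg x]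
    have h0 : 0 ≤ (‖x‖ ^ 2 - a ^ 2) / (b ^ 2 - a ^ 2) :=
      div_nonneg (by nlinarith [norm_nonneg x]) hab'.le
    simp only [h, hcd]
    constructor <;> linarith
  · rw [hcabs, show 2 * (3 / ((b - a) * (b + a))) * ‖x‖ = 6 / (b - a) * (‖x‖ / (b + a)) by
      field_simp; ring]
    refine mul_le_of_le_one_right (by positivity) ?_
    rw [div_le_one (by linarith)]; linarith
  · rw [hcabs, div_pow, ← mul_div_assoc, div_le_div_iff₀ (by nlinarith) (by positivity)]
    nlinarith [mul_pos hba hba, mul_pos hba ha]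

theorem spDeriv_iteratedFDeriv_mul (n : ℕ) (i : Fin n) {j : ℕ} {ψ : Spc n → ℝ} (η : ℝ → ℝ)
    (hψ : ContDiff ℝ (⊤ : ℕ∞) ψ) (v : Fin j → Spc n) :
    spDeriv n i (fun z => iteratedFDeriv ℝ j ψ z.1 v * η z.2) = fun z =>
      iteratedFDeriv ℝ (j + 1) ψ z.1 (Fin.cons (EuclideanSpace.single i (1 : ℝ)) v) * η z.2 := by
  funext z
  simp only [spDeriv]
  set e : Spc n := EuclideanSpace.single i (1 : ℝ)
  have hd : Differentiable ℝ (iteratedFDeriv ℝ j ψ) :=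
    hψ.differentiable_iteratedFDeriv (by exact_mod_cast WithTop.coe_lt_top j)
  have hl : HasDerivAt (fun s : ℝ => z.1 + s • e) e 0 := by
    simpa using ((hasDerivAt_id (0 : ℝ)).smul_const e).const_add z.1
  have h1 : HasDerivAt (fun s : ℝ => iteratedFDeriv ℝ j ψ (z.1 + s • e))
      (fderiv ℝ (iteratedFDeriv ℝ j ψ) z.1 e) 0 := by
    have := (hd (z.1 + (0 : ℝ) • e)).hasFDerivAt.comp_hasDerivAt (0 : ℝ) hl
    simp only [zero_smul, add_zero] at this
    exact this
  have h2 : HasDerivAt (fun s : ℝ => iteratedFDeriv ℝ j ψ (z.1 + s • e) v)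
      (fderiv ℝ (iteratedFDeriv ℝ j ψ) z.1 e v) 0 :=
    (ContinuousMultilinearMap.apply ℝ (fun _ : Fin j => Spc n) ℝ v).hasFDerivAt.comp_hasDerivAt
      (0 : ℝ) h1
  rw [(h2.mul_const _).deriv, iteratedFDeriv_succ_apply_left]
  simp

theorem foldr_spDeriv_mul (n : ℕ) {ψ : Spc n → ℝ} (η : ℝ → ℝ) (hψ : ContDiff ℝ (⊤ : ℕ∞) ψ)
    (α : Fin n → ℕ) (l : List (Fin n)) :
    ∃ v : Fin (l.map α).sum → Spc n, (∀ i, ‖v i‖ ≤ 1) ∧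
      l.foldr (fun i φ => (spDeriv n i)^[α i] φ) (fun z => ψ z.1 * η z.2) =
        fun z => iteratedFDeriv ℝ (l.map α).sum ψ z.1 v * η z.2 := by
  induction l with
  | nil => exact ⟨Fin.elim0, fun i => i.elim0, rfl⟩
  | cons i l ih =>
    obtain ⟨v, hv, h⟩ := ih
    rw [List.foldr_cons, h, List.map_cons, List.sum_cons, add_comm]
    clear h
    induction α i with
    | zero => exact ⟨v, hv, rfl⟩
    | succ q ih =>
      obtain ⟨w, hw, h⟩ := ih
      refine ⟨Fin.cons (EuclideanSpace.single i (1 : ℝ)) w, ?_, ?_⟩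
      · intro j
        refine Fin.cases ?_ (fun j => ?_) j
        · simp
        · simpa using hw j
      · rw [Function.iterate_succ_apply', h, spDeriv_iteratedFDeriv_mul n i η hψ]
        rfl

theorem abs_mDeriv_mul_le {n m : ℕ} {ψ : Spc n → ℝ} (η : ℝ → ℝ) (hψ : ContDiff ℝ (⊤ : ℕ∞) ψ)
    {α : Fin n → ℕ} (hα : α ∈ mIdx n m) (z : Spc n × ℝ) :
    |mDeriv n α (fun z => ψ z.1 * η z.2) z| ≤ ‖iteratedFDeriv ℝ m ψ z.1‖ * |η z.2| := by
  have hs : ((List.finRange n).map α).sum = m := by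
    rw [← (Finset.mem_filter.1 hα).2, ← List.ofFn_eq_map, List.sum_ofFn]
  obtain ⟨v, hv, h⟩ := foldr_spDeriv_mul n η hψ α (List.finRange n)
  rw [mDeriv, h, abs_mul, ← hs]
  gcongr
  refine ((iteratedFDeriv ℝ _ ψ z.1).le_opNorm v).trans ?_
  exact mul_le_of_le_one_right (norm_nonneg _)
    (Finset.prod_le_one (fun _ _ => norm_nonneg _) fun i _ => hv i)

theorem iterate_tDeriv_mul {n : ℕ} (ψ : Spc n → ℝ) (η : ℝ → ℝ) (j : ℕ) :
    (tDeriv n)^[j] (fun z => ψ z.1 * η z.2) = fun z => ψ z.1 * iteratedDeriv j η z.2 := by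
  induction j with
  | zero => simp
  | succ j ih =>
    rw [Function.iterate_succ_apply', ih]
    funext z
    rw [tDeriv, iteratedDeriv_succ]
    exact deriv_const_mul_field (ψ z.1)

theorem measurableSet_halfSp (n : ℕ) : MeasurableSet (halfSp n) :=
  measurableSet_lt measurable_const measurable_snd

theorem measurableSet_cyl (n : ℕ) (r κ : ℝ) : MeasurableSet (cyl n r κ) :=
  measurableSet_ball.prod measurableSet_Ioo

theorem cyl_subset_cyl {n : ℕ} {r s κ ν : ℝ} (h : r ≤ s) (h' : r ^ κ ≤ s ^ ν) :
    cyl n r κ ⊆ cyl n s ν :=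
  prod_mono (Metric.ball_subset_ball h) (Ioo_subset_Ioo_right h')

theorem measureReal_cyl (n : ℕ) {r : ℝ} (κ : ℝ) (hr : 0 < r) :
    volume.real (cyl n r κ) = r ^ n * volume.real (ball0 n 1) * r ^ κ := by
  rw [cyl, Measure.volume_eq_prod, measureReal_prod_prod, ball0, measureReal_def,
    Measure.addHaar_ball_of_pos _ _ hr, finrank_euclideanSpace_fin, ENNReal.toReal_mul,
    ENNReal.toReal_ofReal (by positivity), Real.volume_real_Ioo_of_le (by positivity), sub_zero]
  rfl

theorem measureReal_ball0_pos (n : ℕ) : 0 < volume.real (ball0 n 1) :=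
  ENNReal.toReal_pos (Metric.measure_ball_pos _ _ one_pos).ne' measure_ball_lt_top.ne

theorem measureReal_cyl_pos (n : ℕ) {r : ℝ} (κ : ℝ) (hr : 0 < r) :
    0 < volume.real (cyl n r κ) := by
  rw [measureReal_cyl n κ hr]
  have := measureReal_ball0_pos n
  positivity

theorem integrableOn_cyl_of_one {n : ℕ} {g : Spc n × ℝ → ℝ}
    (hg : ∀ r : ℝ, 0 < r → IntegrableOn g (cyl n r 1)) {r : ℝ} (hr : 0 < r) (κ : ℝ) :
    IntegrableOn g (cyl n r κ) :=
  (hg (max r (r ^ κ)) (lt_max_of_lt_left hr)).mono_set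
    (cyl_subset_cyl (le_max_left _ _) (by rw [rpow_one]; exact le_max_right _ _))

theorem continuousOn_Ici_of_convexOn_of_monotoneOn {f : ℝ → ℝ} (hm : MonotoneOn f (Ici 0))
    (hc : ConvexOn ℝ (Ici 0) f) : ContinuousOn f (Ici 0) := by
  intro x hx
  rcases eq_or_lt_of_le (mem_Ici.1 hx) with rfl | hx0
  · have h1 : Tendsto (fun x : ℝ => (1 - x) * f 0 + x * f 1) (nhdsWithin 0 (Ici 0)) (nhds (f 0)) := by
      have : Continuous (fun x : ℝ => (1 - x) * f 0 + x * f 1) := by fun_prop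
      have := (this.tendsto 0).mono_left (nhdsWithin_le_nhds (s := Ici 0))
      simpa using this
    refine tendsto_of_tendsto_of_tendsto_of_le_of_le' tendsto_const_nhds h1 ?_ ?_
    · filter_upwards [self_mem_nhdsWithin] with y hy
      exact hm hx hy hy
    · filter_upwards [self_mem_nhdsWithin,
        nhdsWithin_le_nhds (gt_mem_nhds (zero_lt_one' ℝ))] with y hy hy1
      have := hc.2 hx (mem_Ici.2 (zero_le_one' ℝ)) (sub_nonneg.2 hy1.le) hy (by ring)
      simpa using this
  · have := hc.continuousOn_interior
    rw [interior_Ici] at this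
    exact (this.continuousAt (Ioi_mem_nhds hx0)).continuousWithinAt

theorem nonneg_of_goodF {p : ℝ} {f : ℝ → ℝ} (hf : GoodF p f) {ζ : ℝ} (hζ : 0 ≤ ζ) : 0 ≤ f ζ := by
  have hc := (continuousOn_Ici_of_convexOn_of_monotoneOn hf.1 hf.2.1 0 self_mem_Ici).mono
    Ioi_subset_Ici_self
  have h0 : 0 ≤ f 0 := ge_of_tendsto hc.tendsto
    (eventually_nhdsWithin_of_forall fun x hx => (hf.2.2.2.2 x hx).le)
  exact h0.trans (hf.1 self_mem_Ici hζ hζ)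

theorem abs_setIntegral_le_of_eq_zero_off {X : Type*} [MeasurableSpace X] {μ : Measure X}
    {s t : Set X} (ht : MeasurableSet t) (hst : s ⊆ t) {G h : X → ℝ}
    (h0 : ∀ x ∈ t \ s, G x = 0) (hh : IntegrableOn h s μ)
    (hG : ∀ᵐ x ∂(μ.restrict s), |G x| ≤ h x) : |∫ x in t, G x ∂μ| ≤ ∫ x in s, h x ∂μ := by
  rw [setIntegral_eq_of_subset_of_forall_sdiff_eq_zero ht hst h0]
  exact norm_integral_le_of_norm_le (f := G) hh hG

/-- The energy inequality obtained by testing the differential inequality with a product of a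
spatial and a temporal cutoff. -/
theorem setIntegral_le_of_isCutoff {n k m : ℕ} (hk : 1 ≤ k) (hm : 1 ≤ m) {A p : ℝ}
    {a : (Fin n → ℕ) → Spc n × ℝ → ℝ → ℝ} {f : ℝ → ℝ} {u0 : ℕ → Spc n → ℝ}
    {u : Spc n × ℝ → ℝ} (hA : 0 < A) (hst : Standing n k m A p a f u0)
    (hsol : IsGlobalWeakSol n k m p a f u0 u) {κ r s : ℝ} (hr : 0 < r) (hrs : r ≤ s)
    (hrs' : r ^ κ ≤ s ^ κ) {ψ : Spc n → ℝ} {η : ℝ → ℝ} (hψ : IsCutoff r s ψ)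
    (hη : IsCutoff (r ^ κ) (s ^ κ) η) {M N : ℝ} (hM : ∀ t, ‖iteratedFDeriv ℝ k η t‖ ≤ M)
    (hN : ∀ x, ‖iteratedFDeriv ℝ m ψ x‖ ≤ N) :
    ∫ z in cyl n r κ, f |u z| ≤ M * (∫ z in cyl n s κ \ cyl n r κ, |u z|) +
      (mIdx n m).card * A * N * ∫ z in cyl n s κ \ cyl n r κ, |u z| ^ p := by
  obtain ⟨hu, hup, hfu, hweak⟩ := hsol
  obtain ⟨ha, hf, -, hu0, -, -⟩ := hst
  have hs : 0 < s := hr.trans_le hrs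
  have hsub : cyl n r κ ⊆ cyl n s κ := cyl_subset_cyl hrs hrs'
  have hhalf : cyl n s κ ⊆ halfSp n := fun z hz => hz.2.1
  have hdiff : cyl n s κ \ cyl n r κ ⊆ halfSp n := sdiff_subset.trans hhalf
  have hrκ : 0 < r ^ κ := rpow_pos_of_pos hr κ
  have hin : ∀ z ∈ cyl n r κ, ‖z.1‖ ≤ r ∧ ‖z.2‖ ≤ r ^ κ := fun z hz =>
    ⟨(mem_ball_zero_iff.1 hz.1).le, by rw [norm_eq_abs, abs_of_pos hz.2.1]; exact hz.2.2.le⟩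
  have hout : ∀ z ∈ halfSp n, z ∉ cyl n s κ → s ≤ ‖z.1‖ ∨ s ^ κ ≤ ‖z.2‖ := by
    intro z hz hz'
    by_contra! h
    refine hz' ⟨mem_ball_zero_iff.2 h.1, hz, ?_⟩
    exact (le_abs_self _).trans_lt h.2
  have hoff : ∀ z ∈ halfSp n \ (cyl n s κ \ cyl n r κ),
      (‖z.1‖ ≤ r ∧ ‖z.2‖ ≤ r ^ κ) ∨ s ≤ ‖z.1‖ ∨ s ^ κ ≤ ‖z.2‖ := by
    intro z hz
    by_cases h : z ∈ cyl n r κ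
    · exact Or.inl (hin z h)
    · exact Or.inr (hout z hz.1 fun h' => hz.2 ⟨h', h⟩)
  have hM' : ∀ t, |iteratedDeriv k η t| ≤ M := fun t => by
    rw [← norm_eq_abs, ← norm_iteratedFDeriv_eq_norm_iteratedDeriv]; exact hM t
  have hN0 : 0 ≤ N := (norm_nonneg _).trans (hN 0)
  have hη0 : ∀ {j : ℕ} (_ : j ≠ 0) {t : ℝ}, (‖t‖ ≤ r ^ κ ∨ s ^ κ ≤ ‖t‖) →
      iteratedDeriv j η t = 0 := fun {j} hj {t} ht => by
    rw [iteratedDeriv_eq_iteratedFDeriv, hη.iteratedFDeriv_eq_zero hj ht]; rfl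
  set φ : Spc n × ℝ → ℝ := fun z => ψ z.1 * η z.2 with hφ
  have hφs : ContDiff ℝ (⊤ : ℕ∞) φ :=
    (hψ.contDiff.comp contDiff_fst).mul (hη.contDiff.comp contDiff_snd)
  have hφc : HasCompactSupport φ := by
    refine HasCompactSupport.intro ((isCompact_closedBall (0 : Spc n) s).prod
      (isCompact_closedBall (0 : ℝ) (s ^ κ))) fun z hz => ?_
    rw [mem_prod, mem_closedBall_zero_iff, mem_closedBall_zero_iff, not_and_or, not_le,
      not_le] at hz
    rcases hz with hz | hz
    · simp [hφ, hψ.eq_zero hz.le]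
    · simp [hφ, hη.eq_zero hz.le]
  have hφ0 : ∀ z, 0 ≤ φ z := fun z => mul_nonneg (hψ.nonneg _) (hη.nonneg _)
  have hφ1 : ∀ z, φ z ≤ 1 := fun z => mul_le_one₀ (hψ.le_one _) (hη.nonneg _) (hη.le_one _)
  have hw := hweak φ hφs hφc hφ0
  have htime : |∫ z in halfSp n, (-1 : ℝ) ^ k * u z * (tDeriv n)^[k] φ z| ≤
      ∫ z in cyl n s κ \ cyl n r κ, M * |u z| := by
    rw [hφ, iterate_tDeriv_mul]
    refine abs_setIntegral_le_of_eq_zero_off (measurableSet_halfSp n) hdiff ?_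
      (((integrableOn_cyl_of_one hu hs κ).mono_set sdiff_subset).abs.const_mul M)
      (Eventually.of_forall fun z => ?_)
    · intro z hz
      rcases hoff z hz with h | h | h
      · simp [hη0 (by omega : k ≠ 0) (Or.inl h.2)]
      · simp [hψ.eq_zero h]
      · simp [hη0 (by omega : k ≠ 0) (Or.inr h)]
    · simp only [abs_mul, abs_pow, abs_neg, abs_one, one_pow, one_mul]
      rw [mul_comm M]
      gcongr
      rw [abs_of_nonneg (hψ.nonneg _)]
      exact (mul_le_of_le_one_left (abs_nonneg _) (hψ.le_one _)).trans (hM' _)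
  have hspace : |∫ z in halfSp n, ∑ α ∈ mIdx n m, (-1 : ℝ) ^ m * a α z (u z) * mDeriv n α φ z| ≤
      ∫ z in cyl n s κ \ cyl n r κ, (mIdx n m).card * A * N * |u z| ^ p := by
    refine abs_setIntegral_le_of_eq_zero_off (measurableSet_halfSp n) hdiff ?_
      (((integrableOn_cyl_of_one hup hs κ).mono_set sdiff_subset).const_mul _) ?_
    · intro z hz
      refine Finset.sum_eq_zero fun α hα => ?_
      have := abs_mDeriv_mul_le η hψ.contDiff hα z
      have h0 : ‖iteratedFDeriv ℝ m ψ z.1‖ * |η z.2| = 0 := by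
        rcases hoff z hz with h | h | h
        · simp [hψ.iteratedFDeriv_eq_zero (by omega : m ≠ 0) (Or.inl h.1)]
        · simp [hψ.iteratedFDeriv_eq_zero (by omega : m ≠ 0) (Or.inr h)]
        · simp [hη.eq_zero h]
      rw [h0] at this
      rw [abs_nonpos_iff.1 this, mul_zero]
    · have hae : ∀ᵐ z ∂(volume.restrict (halfSp n)), ∀ α ∈ mIdx n m,
          |a α z (u z)| ≤ A * |u z| ^ p := by
        rw [Finset.eventually_all]
        intro α hα
        filter_upwards [(ha α hα).2.2] with z hz using hz _
      filter_upwards [ae_restrict_of_ae_restrict_of_subset hdiff hae] with z hz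
      calc |∑ α ∈ mIdx n m, (-1 : ℝ) ^ m * a α z (u z) * mDeriv n α φ z|
          ≤ ∑ α ∈ mIdx n m, |(-1 : ℝ) ^ m * a α z (u z) * mDeriv n α φ z| :=
            Finset.abs_sum_le_sum_abs _ _
        _ ≤ ∑ α ∈ mIdx n m, A * |u z| ^ p * N := by
            refine Finset.sum_le_sum fun α hα => ?_
            simp only [abs_mul, abs_pow, abs_neg, abs_one, one_pow, one_mul]
            have h1 : |mDeriv n α φ z| ≤ N := by
              refine (abs_mDeriv_mul_le η hψ.contDiff hα z).trans ?_
              rw [abs_of_nonneg (hη.nonneg _)]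
              exact (mul_le_of_le_one_right (norm_nonneg _) (hη.le_one _)).trans (hN _)
            gcongr
            exact hz α hα
        _ = _ := by rw [Finset.sum_const, nsmul_eq_mul]; ring
  have hinit : 0 ≤ ∫ x : Spc n, ∑ i ∈ Finset.range k,
      (-1 : ℝ) ^ i * u0 (k - 1 - i) x * (tDeriv n)^[i] φ (x, 0) := by
    refine integral_nonneg_of_ae ?_
    filter_upwards [hu0] with x hx
    refine Finset.sum_nonneg fun i _ => ?_
    rw [hφ, iterate_tDeriv_mul]
    rcases Nat.eq_zero_or_pos i with rfl | hi
    · simpa using mul_nonneg hx (mul_nonneg (hψ.nonneg x) (hη.nonneg 0))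
    · simp [hη0 hi.ne' (t := 0) (Or.inl (by simpa using hrκ.le))]
  have hf0 : ∀ z, 0 ≤ f |u z| := fun z => nonneg_of_goodF hf (abs_nonneg _)
  have hsource : ∫ z in cyl n r κ, f |u z| ≤ ∫ z in halfSp n, f |u z| * φ z := by
    have hint : IntegrableOn (fun z => f |u z| * φ z) (cyl n s κ) := by
      have h := integrableOn_cyl_of_one hfu hs κ
      refine Integrable.mono h (h.1.mul hφs.continuous.aestronglyMeasurable)
        (Eventually.of_forall fun z => ?_)
      rw [norm_mul, norm_of_nonneg (hφ0 z)]
      exact mul_le_of_le_one_right (norm_nonneg _) (hφ1 z)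
    calc ∫ z in cyl n r κ, f |u z| = ∫ z in cyl n r κ, f |u z| * φ z := by
          refine setIntegral_congr_fun (measurableSet_cyl n r κ) fun z hz => ?_
          simp [hφ, hψ.eq_one (hin z hz).1, hη.eq_one (hin z hz).2]
      _ ≤ ∫ z in cyl n s κ, f |u z| * φ z :=
          setIntegral_mono_set hint
            (Eventually.of_forall fun z => mul_nonneg (hf0 z) (hφ0 z)) hsub.eventuallyLE
      _ = ∫ z in halfSp n, f |u z| * φ z := by
          refine (setIntegral_eq_of_subset_of_forall_sdiff_eq_zero (measurableSet_halfSp n) hhalf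
            fun z hz => ?_).symm
          rcases hout z hz.1 hz.2 with h | h
          · simp [hφ, hψ.eq_zero h]
          · simp [hφ, hη.eq_zero h]
  rw [integral_const_mul] at htime hspace
  linarith [le_abs_self (∫ z in halfSp n, (-1 : ℝ) ^ k * u z * (tDeriv n)^[k] φ z),
    neg_abs_le (∫ z in halfSp n, ∑ α ∈ mIdx n m, (-1 : ℝ) ^ m * a α z (u z) * mDeriv n α φ z)]

theorem exists_le_rpow_sub_rpow {κ : ℝ} (hκ : 0 < κ) :
    ∃ c : ℝ, 0 < c ∧ ∀ R r s : ℝ, 0 < R → R ≤ r → r < s → s ≤ 2 * R →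
      c * ((s - r) * R ^ (κ - 1)) ≤ s ^ κ - r ^ κ := by
  refine ⟨κ * min 1 (2 ^ (κ - 1)), by positivity, fun R r s hR hRr hrs hs => ?_⟩
  have hr : 0 < r := hR.trans_le hRr
  obtain ⟨ξ, hξ, h⟩ := exists_deriv_eq_slope (fun x : ℝ => x ^ κ) hrs
    (continuous_rpow_const hκ.le).continuousOn
    fun x hx => (differentiableAt_rpow_const_of_ne κ
      (hr.trans hx.1).ne').differentiableWithinAt
  have hξ0 : 0 < ξ := hr.trans hξ.1
  rw [Real.deriv_rpow_const, eq_div_iff (sub_pos.2 hrs).ne'] at h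
  have key : min 1 (2 ^ (κ - 1)) * R ^ (κ - 1) ≤ ξ ^ (κ - 1) := by
    rcases le_total 1 κ with h1 | h1
    · calc min 1 (2 ^ (κ - 1)) * R ^ (κ - 1) ≤ 1 * R ^ (κ - 1) := by gcongr; exact min_le_left _ _
        _ ≤ ξ ^ (κ - 1) := by
          rw [one_mul]
          exact rpow_le_rpow hR.le (hRr.trans hξ.1.le) (by linarith)
    · calc min 1 (2 ^ (κ - 1)) * R ^ (κ - 1) ≤ 2 ^ (κ - 1) * R ^ (κ - 1) := by
            gcongr; exact min_le_right _ _
        _ = (2 * R) ^ (κ - 1) := (mul_rpow zero_le_two hR.le).symm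
        _ ≤ ξ ^ (κ - 1) :=
          rpow_le_rpow_of_nonpos hξ0 (hξ.2.le.trans hs) (by linarith)
  calc κ * min 1 (2 ^ (κ - 1)) * ((s - r) * R ^ (κ - 1))
      = κ * (min 1 (2 ^ (κ - 1)) * R ^ (κ - 1)) * (s - r) := by ring
    _ ≤ κ * ξ ^ (κ - 1) * (s - r) := by
      have := sub_pos.2 hrs
      gcongr
    _ = s ^ κ - r ^ κ := h

theorem measureReal_cyl_two_mul_le {n : ℕ} {κ R r : ℝ} (hκ : 0 < κ) (hR : 0 < R) (hr : R ≤ r) :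
    volume.real (cyl n (2 * R) κ) ≤ 2 ^ n * 2 ^ κ * volume.real (cyl n r κ) := by
  have hr0 : 0 < r := hR.trans_le hr
  rw [measureReal_cyl n κ (by positivity), measureReal_cyl n κ hr0, mul_pow,
    mul_rpow zero_le_two hR.le]
  calc 2 ^ n * R ^ n * volume.real (ball0 n 1) * (2 ^ κ * R ^ κ)
      = 2 ^ n * 2 ^ κ * (R ^ n * volume.real (ball0 n 1) * R ^ κ) := by ring
    _ ≤ _ := by gcongr

theorem map_inv_mul_setIntegral_le {X : Type*} [MeasurableSpace X] {μ : Measure X} {s : Set X}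
    (hs : 0 < μ.real s) {V K : ℝ} (hsV : μ.real s ≤ V) (hV : V ≤ K * μ.real s) {p : ℝ} {f : ℝ → ℝ}
    (hf : GoodF p f) {u : X → ℝ} (hu : IntegrableOn u s μ)
    (hfu : IntegrableOn (fun x => f |u x|) s μ) :
    f (V⁻¹ * ∫ x in s, |u x| ∂μ) ≤ K * (V⁻¹ * ∫ x in s, f |u x| ∂μ) := by
  have hs' : μ s ≠ 0 ∧ μ s ≠ ⊤ := by
    rw [measureReal_def, ENNReal.toReal_pos_iff] at hs
    exact ⟨hs.1.ne', hs.2.ne⟩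
  have : IsFiniteMeasure (μ.restrict s) := isFiniteMeasure_restrict.2 hs'.2
  have : NeZero (μ.restrict s) := ⟨by simpa using hs'.1⟩
  have hV0 : 0 < V := hs.trans_le hsV
  have hI : 0 ≤ ∫ x in s, |u x| ∂μ := integral_nonneg fun _ => abs_nonneg _
  have hfI : 0 ≤ ∫ x in s, f |u x| ∂μ :=
    integral_nonneg fun _ => nonneg_of_goodF hf (abs_nonneg _)
  have hJ := hf.2.1.map_average_le (continuousOn_Ici_of_convexOn_of_monotoneOn hf.1 hf.2.1)
    isClosed_Ici (Eventually.of_forall fun x => abs_nonneg (u x)) hu.abs hfu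
  rw [setAverage_eq, setAverage_eq, smul_eq_mul, smul_eq_mul] at hJ
  calc f (V⁻¹ * ∫ x in s, |u x| ∂μ) ≤ f ((μ.real s)⁻¹ * ∫ x in s, |u x| ∂μ) := by
        refine hf.1 (mem_Ici.2 (by positivity)) (mem_Ici.2 (by positivity)) ?_
        gcongr
    _ ≤ (μ.real s)⁻¹ * ∫ x in s, f |u x| ∂μ := hJ
    _ ≤ (K * V⁻¹) * ∫ x in s, f |u x| ∂μ := by
        gcongr
        rw [← div_eq_mul_inv, le_div_iff₀ hV0, inv_mul_le_iff₀ hs]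
        linarith
    _ = _ := by ring

theorem inv_mul_setIntegral_rpow_le {X : Type*} [MeasurableSpace X] {μ : Measure X} {s t : Set X}
    (hs : MeasurableSet s) (hst : s ⊆ t) (ht : 0 < μ.real t) {p : ℝ} (hp0 : 0 < p) (hp1 : p ≤ 1)
    {u : X → ℝ} (hu : IntegrableOn u t μ) (hup : IntegrableOn (fun x => |u x| ^ p) t μ) :
    (μ.real t)⁻¹ * ∫ x in s, |u x| ^ p ∂μ ≤ ((μ.real t)⁻¹ * ∫ x in s, |u x| ∂μ) ^ p := by
  have ht' : μ t ≠ 0 ∧ μ t ≠ ⊤ := by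
    rw [measureReal_def, ENNReal.toReal_pos_iff] at ht
    exact ⟨ht.1.ne', ht.2.ne⟩
  have : IsFiniteMeasure (μ.restrict t) := isFiniteMeasure_restrict.2 ht'.2
  have : NeZero (μ.restrict t) := ⟨by simpa using ht'.1⟩
  have hpow : (fun x => s.indicator (fun x => |u x|) x ^ p) = s.indicator fun x => |u x| ^ p := by
    funext x
    by_cases hx : x ∈ s <;> simp [hx, hp0.ne']
  have hJ := (Real.concaveOn_rpow hp0.le hp1).le_map_average (μ := μ.restrict t)
    (f := s.indicator fun x => |u x|) (continuous_rpow_const hp0.le).continuousOn isClosed_Ici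
    (Eventually.of_forall fun x => indicator_nonneg (fun x _ => abs_nonneg (u x)) x)
    (hu.abs.indicator hs) (by
      change Integrable (fun x => s.indicator (fun x => |u x|) x ^ p) _
      rw [hpow]
      exact hup.indicator hs)
  simp only [hpow] at hJ
  rwa [setAverage_eq, setAverage_eq, smul_eq_mul, smul_eq_mul, setIntegral_indicator hs,
    setIntegral_indicator hs, inter_eq_right.2 hst] at hJ

theorem mul_rpow_le_of_le_mul_rpow_div {F X B K d m p : ℝ} (hF : 0 ≤ F) (hX : 0 ≤ X) (hB : 0 < B)
    (hK : 0 < K) (hd : 0 < d) (hp : 0 < p) (h : F ≤ K * (B * X ^ p / d ^ m)) :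
    (1 / (K * B)) ^ (1 / p) * (d ^ (m / p) * F ^ (1 / p)) ≤ X := by
  have hdm : 0 < d ^ m := rpow_pos_of_pos hd m
  have h1 : 1 / (K * B) * (d ^ m * F) ≤ X ^ p := by
    rw [mul_div_assoc', le_div_iff₀ hdm] at h
    rw [one_div, inv_mul_le_iff₀ (by positivity)]
    linarith
  calc (1 / (K * B)) ^ (1 / p) * (d ^ (m / p) * F ^ (1 / p))
      = (1 / (K * B) * (d ^ m * F)) ^ (1 / p) := by
        rw [mul_rpow (by positivity) (by positivity), mul_rpow hdm.le hF, ← rpow_mul hd.le,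
          mul_one_div]
    _ ≤ (X ^ p) ^ (1 / p) := by gcongr
    _ = X := by rw [one_div, rpow_rpow_inv hX hp.ne']

/-- **Lemma 3.3.** Let `0 < p < 1`. For every `κ > 0` there is `C > 0`, depending only
on `A, k, m, n, p, κ`, such that for every global weak solution `u`, all `R > 0` and
all `R ≤ r₁ < r₂ ≤ 2R`, with `J(r) = (mes Q_{2R}^κ)⁻¹ ∫_{Q_r^κ} |u|`, at least one of
`J(r₂) - J(r₁) ≥ C (r₂ - r₁)^k R^{k(κ-1)} f(J(r₁))` or
`J(r₂) - J(r₁) ≥ C (r₂ - r₁)^{m/p} f(J(r₁))^{1/p}` holds. -/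
theorem lemma_3_3
    (n k m : ℕ) (hn : 1 ≤ n) (hk : 1 ≤ k) (hm : 1 ≤ m)
    (A p : ℝ) (hA : 0 < A) (hp0 : 0 < p) (hp1 : p < 1) (κ : ℝ) (hκ : 0 < κ) :
    ∃ C : ℝ, 0 < C ∧
      ∀ (a : (Fin n → ℕ) → Spc n × ℝ → ℝ → ℝ) (f : ℝ → ℝ) (u0 : ℕ → Spc n → ℝ)
        (u : Spc n × ℝ → ℝ), Standing n k m A p a f u0 →
        IsGlobalWeakSol n k m p a f u0 u →
        ∀ R r₁ r₂ : ℝ, 0 < R → R ≤ r₁ → r₁ < r₂ → r₂ ≤ 2 * R →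
        ∀ J : ℝ → ℝ,
          (∀ r : ℝ, J r = (volume (cyl n (2 * R) κ)).toReal⁻¹ * ∫ z in cyl n r κ, |u z|) →
          C * ((r₂ - r₁) ^ (k : ℕ) * R ^ ((k : ℝ) * (κ - 1)) * f (J r₁)) ≤ J r₂ - J r₁ ∨
          C * ((r₂ - r₁) ^ ((m : ℝ) / p) * f (J r₁) ^ (1 / p)) ≤ J r₂ - J r₁ := by
  obtain ⟨C₁, hC₁, hcut₁⟩ := exists_isCutoff ℝ k (by omega)
  obtain ⟨C₂, hC₂, hcut₂⟩ := exists_isCutoff (Spc n) m (by omega)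
  obtain ⟨c, hc, hpow⟩ := exists_le_rpow_sub_rpow hκ
  set B : ℝ := (mIdx n m).card * A * C₂ + 1 with hB
  have hB0 : 0 < B := by positivity
  set K : ℝ := 2 ^ n * 2 ^ κ with hK
  have hK0 : 0 < K := by positivity
  refine ⟨min (c ^ k / (2 * K * C₁)) ((1 / (2 * K * B)) ^ (1 / p)), by positivity, ?_⟩
  intro a f u0 u hst hsol R r₁ r₂ hR hRr hrr hr₂ J hJ
  have hr₁ : 0 < r₁ := hR.trans_le hRr
  have hd : 0 < r₂ - r₁ := sub_pos.2 hrr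
  have hT : r₁ ^ κ < r₂ ^ κ := rpow_lt_rpow hr₁.le hrr hκ
  have hT2 : r₂ ^ κ ≤ (2 * R) ^ κ := rpow_le_rpow (hr₁.trans hrr).le hr₂ hκ.le
  have hdT : 0 < r₂ ^ κ - r₁ ^ κ := sub_pos.2 hT
  obtain ⟨η, hη, hηb⟩ := hcut₁ _ _ (rpow_pos_of_pos hr₁ κ) hT
  obtain ⟨ψ, hψ, hψb⟩ := hcut₂ _ _ hr₁ hrr
  have hE := setIntegral_le_of_isCutoff hk hm hA hst hsol hr₁ hrr.le hT.le hψ hη hηb hψb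
  have hf := hst.2.1
  have h2R : 0 < 2 * R := by positivity
  have hsub₁ : cyl n r₁ κ ⊆ cyl n r₂ κ := cyl_subset_cyl hrr.le hT.le
  have hsub₂ : cyl n r₂ κ ⊆ cyl n (2 * R) κ := cyl_subset_cyl hr₂ hT2
  have hu := fun r (hr : 0 < r) => integrableOn_cyl_of_one hsol.1 hr κ
  have hV₁ := measureReal_cyl_pos n κ hr₁
  have hV := measureReal_cyl_pos n κ h2R
  set V := volume.real (cyl n (2 * R) κ) with hVdef
  have hVtop : volume (cyl n (2 * R) κ) ≠ ⊤ := by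
    rw [hVdef, measureReal_def, ENNReal.toReal_pos_iff] at hV
    exact hV.2.ne
  have hdiff : J r₂ - J r₁ = V⁻¹ * ∫ z in cyl n r₂ κ \ cyl n r₁ κ, |u z| := by
    rw [setIntegral_sdiff (measurableSet_cyl n r₁ κ) (hu r₂ (hr₁.trans hrr)).abs hsub₁, hJ, hJ,
      ← mul_sub, ← measureReal_def]
  set X := J r₂ - J r₁ with hX
  have hX0 : 0 ≤ X := by
    rw [hdiff]
    exact mul_nonneg (by positivity) (integral_nonneg fun _ => abs_nonneg _)
  have hJ0 : 0 ≤ J r₁ := by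
    rw [hJ]
    exact mul_nonneg (by positivity) (integral_nonneg fun _ => abs_nonneg _)
  have hF0 : 0 ≤ f (J r₁) := nonneg_of_goodF hf hJ0
  have hjensen : f (J r₁) ≤ K * (V⁻¹ * ∫ z in cyl n r₁ κ, f |u z|) := by
    rw [hJ, ← measureReal_def]
    exact map_inv_mul_setIntegral_le hV₁ (measureReal_mono (hsub₁.trans hsub₂) hVtop)
      (measureReal_cyl_two_mul_le hκ hR hRr) hf (hu _ hr₁)
      (integrableOn_cyl_of_one hsol.2.2.1 hr₁ κ)
  have hpower : V⁻¹ * ∫ z in cyl n r₂ κ \ cyl n r₁ κ, |u z| ^ p ≤ X ^ p := by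
    rw [hdiff]
    exact inv_mul_setIntegral_rpow_le ((measurableSet_cyl n r₂ κ).diff (measurableSet_cyl n r₁ κ))
      (sdiff_subset.trans hsub₂) hV hp0 hp1.le (hu _ h2R)
      (integrableOn_cyl_of_one hsol.2.1 h2R κ)
  have hmain : f (J r₁) ≤
      K * (C₁ / (r₂ ^ κ - r₁ ^ κ) ^ k * X + B * X ^ p / (r₂ - r₁) ^ (m : ℝ)) := by
    refine hjensen.trans ?_
    gcongr
    calc V⁻¹ * ∫ z in cyl n r₁ κ, f |u z|
        ≤ V⁻¹ * (C₁ / (r₂ ^ κ - r₁ ^ κ) ^ k * (∫ z in cyl n r₂ κ \ cyl n r₁ κ, |u z|) +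
          (mIdx n m).card * A * (C₂ / (r₂ - r₁) ^ m) *
            ∫ z in cyl n r₂ κ \ cyl n r₁ κ, |u z| ^ p) := by gcongr
      _ = C₁ / (r₂ ^ κ - r₁ ^ κ) ^ k * X + (mIdx n m).card * A * C₂ / (r₂ - r₁) ^ m *
            (V⁻¹ * ∫ z in cyl n r₂ κ \ cyl n r₁ κ, |u z| ^ p) := by rw [hdiff]; ring
      _ ≤ C₁ / (r₂ ^ κ - r₁ ^ κ) ^ k * X + B / (r₂ - r₁) ^ m * X ^ p := by
          gcongr
          rw [hB]; linarith
      _ = _ := by rw [rpow_natCast]; ring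
  rcases le_total (B * X ^ p / (r₂ - r₁) ^ (m : ℝ)) (C₁ / (r₂ ^ κ - r₁ ^ κ) ^ k * X) with h | h
  · left
    have h1 : f (J r₁) ≤ 2 * K * C₁ * X / (r₂ ^ κ - r₁ ^ κ) ^ k := by
      calc f (J r₁) ≤ _ := hmain
        _ ≤ K * (C₁ / (r₂ ^ κ - r₁ ^ κ) ^ k * X + C₁ / (r₂ ^ κ - r₁ ^ κ) ^ k * X) := by gcongr
        _ = _ := by ring
    rw [le_div_iff₀ (by positivity)] at h1
    have hRk : R ^ ((k : ℝ) * (κ - 1)) = (R ^ (κ - 1)) ^ k := by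
      rw [mul_comm, rpow_mul_natCast hR.le]
    calc _ ≤ c ^ k / (2 * K * C₁) *
          ((r₂ - r₁) ^ k * R ^ ((k : ℝ) * (κ - 1)) * f (J r₁)) := by
          gcongr
          exact min_le_left _ _
      _ = f (J r₁) * (c * ((r₂ - r₁) * R ^ (κ - 1))) ^ k / (2 * K * C₁) := by
          rw [hRk, mul_pow, mul_pow]; ring
      _ ≤ f (J r₁) * (r₂ ^ κ - r₁ ^ κ) ^ k / (2 * K * C₁) := by
          gcongr
          exact hpow R r₁ r₂ hR hRr hrr hr₂
      _ ≤ X := by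
          rw [div_le_iff₀ (by positivity)]
          linarith
  · right
    refine le_trans ?_ (mul_rpow_le_of_le_mul_rpow_div (m := m) (K := 2 * K) hF0 hX0 hB0
      (by positivity) hd hp0 ?_)
    · gcongr
      exact min_le_right _ _
    · calc f (J r₁) ≤ _ := hmain
        _ ≤ K * (B * X ^ p / (r₂ - r₁) ^ (m : ℝ) + B * X ^ p / (r₂ - r₁) ^ (m : ℝ)) := by gcongr
        _ = _ := by ring
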